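/- Diamond property of parallel reduction: for φ-terms t, u, v, if t ⇛ u and t ⇛ v then there exists a φ-term w such that u ⇛ w and v ⇛ w. -/

import Mathlib

namespace PhiCalc

/-- φ-terms over a set of attribute labels `L`. An object term carries a finite
list of attributes: `(a, none)` is a void attribute, `(b, some t)` is an
attached attribute. -/
inductive Tm (L : Type) : Type where
  | loc : Nat → Tm L
  | dot : Tm L → L → Tm L
  | app : Tm L → L → Tm L → Tm L
  | obj : List (L × Option (Tm L)) → Tm L

namespace Tm

variable {L : Type}

/-- Look up a label among the attributes of an object:
`none` = the label is missing, `some none` = void attribute,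
`some (some t)` = attribute attached to `t`. -/
def lookupAttr [DecidableEq L] (a : L) : List (L × Option (Tm L)) → Option (Option (Tm L))
  | [] => none
  | (b, o) :: rest => if a = b then some o else lookupAttr a rest

/-- Attach term `u` to the (first occurrence of) label `a`. -/
def attachAttr [DecidableEq L] (a : L) (u : Tm L) :
    List (L × Option (Tm L)) → List (L × Option (Tm L))
  | [] => []
  | (b, o) :: rest => if a = b then (b, some u) :: rest else (b, o) :: attachAttr a u rest

mutual
/-- Locator increment `↑ₙ t`. -/
def incAt : Nat → Tm L → Tm L
  | n, loc m => if m < n then loc m else loc (m + 1)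
  | n, dot t a => dot (incAt n t) a
  | n, app t a u => app (incAt n t) a (incAt n u)
  | n, obj attrs => obj (incAtList (n + 1) attrs)

def incAtList : Nat → List (L × Option (Tm L)) → List (L × Option (Tm L))
  | _, [] => []
  | n, (a, none) :: rest => (a, none) :: incAtList n rest
  | n, (a, some t) :: rest => (a, some (incAt n t)) :: incAtList n rest
end

mutual
/-- Locator substitution `t[ρ^n ↦ u]`. -/
def subst : Tm L → Nat → Tm L → Tm L
  | loc m, n, u => if m < n then loc m else if m = n then u else loc (m - 1)
  | dot t a, n, u => dot (subst t n u) a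
  | app t a v, n, u => app (subst t n u) a (subst v n u)
  | obj attrs, n, u => obj (substList attrs (n + 1) (incAt 0 u))

def substList : List (L × Option (Tm L)) → Nat → Tm L → List (L × Option (Tm L))
  | [], _, _ => []
  | (a, none) :: rest, n, u => (a, none) :: substList rest n u
  | (a, some t) :: rest, n, u => (a, some (subst t n u)) :: substList rest n u
end

section Reductions

variable [DecidableEq L]

/-- One-step (regular) reduction `⇝`, parametrized by the decorator label `phi`. -/
inductive Step (phi : L) : Tm L → Tm L → Prop where
  | congObj {t t' : Tm L} (pre post : List (L × Option (Tm L))) (b : L) :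
      Step phi t t' →
      Step phi (obj (pre ++ (b, some t) :: post)) (obj (pre ++ (b, some t') :: post))
  | congDot {t t' : Tm L} (a : L) : Step phi t t' → Step phi (dot t a) (dot t' a)
  | congAppL {t t' u : Tm L} (a : L) : Step phi t t' → Step phi (app t a u) (app t' a u)
  | congAppR {t u u' : Tm L} (a : L) : Step phi u u' → Step phi (app t a u) (app t a u')
  | dotStep {attrs : List (L × Option (Tm L))} {c : L} {tc : Tm L} :
      lookupAttr c attrs = some (some tc) →
      Step phi (dot (obj attrs) c) (subst tc 0 (obj attrs))
  | dotPhi {attrs : List (L × Option (Tm L))} {c : L} :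
      lookupAttr c attrs = none → (lookupAttr phi attrs).isSome →
      Step phi (dot (obj attrs) c) (dot (dot (obj attrs) phi) c)
  | appStep {attrs : List (L × Option (Tm L))} {c : L} {u : Tm L} :
      lookupAttr c attrs = some none →
      Step phi (app (obj attrs) c u) (obj (attachAttr c (incAt 0 u) attrs))

mutual
/-- Parallel reduction `⇛`. -/
inductive Par (phi : L) : Tm L → Tm L → Prop where
  | loc (n : Nat) : Par phi (Tm.loc n) (Tm.loc n)
  | obj {attrs attrs' : List (L × Option (Tm L))} :
      ParAttrs phi attrs attrs' → Par phi (Tm.obj attrs) (Tm.obj attrs')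
  | congDot {t t' : Tm L} (a : L) : Par phi t t' → Par phi (Tm.dot t a) (Tm.dot t' a)
  | congApp {t t' u u' : Tm L} (a : L) :
      Par phi t t' → Par phi u u' → Par phi (Tm.app t a u) (Tm.app t' a u')
  | dotPar {t : Tm L} {attrs : List (L × Option (Tm L))} {c : L} {tc : Tm L} :
      Par phi t (Tm.obj attrs) → lookupAttr c attrs = some (some tc) →
      Par phi (Tm.dot t c) (subst tc 0 (Tm.obj attrs))
  | dotPhi {t : Tm L} {attrs : List (L × Option (Tm L))} {c : L} :
      Par phi t (Tm.obj attrs) → lookupAttr c attrs = none →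
      (lookupAttr phi attrs).isSome →
      Par phi (Tm.dot t c) (Tm.dot (Tm.dot (Tm.obj attrs) phi) c)
  | appPar {t : Tm L} {attrs : List (L × Option (Tm L))} {c : L} {u u' : Tm L} :
      Par phi t (Tm.obj attrs) → lookupAttr c attrs = some none → Par phi u u' →
      Par phi (Tm.app t c u) (Tm.obj (attachAttr c (incAt 0 u') attrs))

/-- Pointwise parallel reduction on attribute lists: void attributes are kept,
attached attributes reduce in parallel. -/
inductive ParAttrs (phi : L) :
    List (L × Option (Tm L)) → List (L × Option (Tm L)) → Prop where
  | nil : ParAttrs phi [] []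
  | void {rest rest' : List (L × Option (Tm L))} (a : L) :
      ParAttrs phi rest rest' → ParAttrs phi ((a, none) :: rest) ((a, none) :: rest')
  | attached {t t' : Tm L} {rest rest' : List (L × Option (Tm L))} (a : L) :
      Par phi t t' → ParAttrs phi rest rest' →
      ParAttrs phi ((a, some t) :: rest) ((a, some t') :: rest')
end

/-- Head reduction `→h`. -/
inductive Head (phi : L) : Tm L → Tm L → Prop where
  | dotStep {attrs : List (L × Option (Tm L))} {c : L} {tc : Tm L} :
      lookupAttr c attrs = some (some tc) →
      Head phi (dot (obj attrs) c) (subst tc 0 (obj attrs))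
  | dotPhi {attrs : List (L × Option (Tm L))} {c : L} :
      lookupAttr c attrs = none → (lookupAttr phi attrs).isSome →
      Head phi (dot (obj attrs) c) (dot (dot (obj attrs) phi) c)
  | appStep {attrs : List (L × Option (Tm L))} {c : L} {u : Tm L} :
      lookupAttr c attrs = some none →
      Head phi (app (obj attrs) c u) (obj (attachAttr c (incAt 0 u) attrs))
  | congDot {t t' : Tm L} (a : L) : Head phi t t' → Head phi (dot t a) (dot t' a)
  | congApp {t t' u : Tm L} (a : L) : Head phi t t' → Head phi (app t a u) (app t' a u)

/-- Internal parallel reduction `⇛ᵢ`. -/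
inductive ParI (phi : L) : Tm L → Tm L → Prop where
  | loc (n : Nat) : ParI phi (Tm.loc n) (Tm.loc n)
  | obj {attrs attrs' : List (L × Option (Tm L))} :
      ParAttrs phi attrs attrs' → ParI phi (Tm.obj attrs) (Tm.obj attrs')
  | congDot {t t' : Tm L} (a : L) : ParI phi t t' → ParI phi (Tm.dot t a) (Tm.dot t' a)
  | congApp {t t' u u' : Tm L} (a : L) :
      ParI phi t t' → Par phi u u' → ParI phi (Tm.app t a u) (Tm.app t' a u')

/-- Internal (regular) reduction `→ᵢ`. -/
inductive StepI (phi : L) : Tm L → Tm L → Prop where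
  | congObj {t t' : Tm L} (pre post : List (L × Option (Tm L))) (b : L) :
      Step phi t t' →
      StepI phi (obj (pre ++ (b, some t) :: post)) (obj (pre ++ (b, some t') :: post))
  | congDot {t t' : Tm L} (a : L) : StepI phi t t' → StepI phi (dot t a) (dot t' a)
  | congAppL {t t' u : Tm L} (a : L) : StepI phi t t' → StepI phi (app t a u) (app t' a u)
  | congAppR {t u u' : Tm L} (a : L) : Step phi u u' → StepI phi (app t a u) (app t a u')

end Reductions

end Tm

end PhiCalc
namespace PhiCalc
namespace Tm
section Extra
variable {L : Type} [DecidableEq L]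

mutual
/-- Complete development `t⁺`. -/
def cd (phi : L) : Tm L → Tm L
  | loc n => loc n
  | dot t a =>
    match cd phi t with
    | obj attrs =>
      match lookupAttr a attrs with
      | some (some ta) => subst ta 0 (obj attrs)
      | some none => dot (obj attrs) a
      | none =>
        if (lookupAttr phi attrs).isSome then dot (dot (obj attrs) phi) a
        else dot (obj attrs) a
    | t' => dot t' a
  | app t a u =>
    match cd phi t with
    | obj attrs =>
      match lookupAttr a attrs with
      | some none => obj (attachAttr a (incAt 0 (cd phi u)) attrs)
      | _ => app (obj attrs) a (cd phi u)
    | t' => app t' a (cd phi u)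
  | obj attrs => obj (cdList phi attrs)

def cdList (phi : L) : List (L × Option (Tm L)) → List (L × Option (Tm L))
  | [] => []
  | (a, none) :: rest => (a, none) :: cdList phi rest
  | (a, some t) :: rest => (a, some (cd phi t)) :: cdList phi rest
end

/-- Head reduction as a (deterministic) partial function. -/
def headRed (phi : L) : Tm L → Option (Tm L)
  | loc _ => none
  | obj _ => none
  | dot t a =>
    match t with
    | obj attrs =>
      match lookupAttr a attrs with
      | some (some ta) => some (subst ta 0 (obj attrs))
      | some none => none
      | none =>
        if (lookupAttr phi attrs).isSome then some (dot (dot (obj attrs) phi) a)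
        else none
    | t => (headRed phi t).map (fun t' => dot t' a)
  | app t a u =>
    match t with
    | obj attrs =>
      match lookupAttr a attrs with
      | some none => some (obj (attachAttr a (incAt 0 u) attrs))
      | _ => none
    | t => (headRed phi t).map (fun t' => app t' a u)

mutual
/-- Normal order reduction `⇝ℓ` as a (deterministic) partial function:
head reduction first, otherwise reduce the leftmost subterm that reduces. -/
def nordRed (phi : L) : Tm L → Option (Tm L)
  | loc _ => none
  | dot t a =>
    match headRed phi (dot t a) with
    | some s => some s
    | none => (nordRed phi t).map (fun t' => dot t' a)
  | app t a u =>
    match headRed phi (app t a u) with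
    | some s => some s
    | none =>
      match nordRed phi t with
      | some t' => some (app t' a u)
      | none => (nordRed phi u).map (fun u' => app t a u')
  | obj attrs => (nordList phi attrs).map obj

def nordList (phi : L) : List (L × Option (Tm L)) → Option (List (L × Option (Tm L)))
  | [] => none
  | (a, none) :: rest => (nordList phi rest).map (fun rest' => (a, none) :: rest')
  | (a, some t) :: rest =>
    match nordRed phi t with
    | some t' => some ((a, some t') :: rest)
    | none => (nordList phi rest).map (fun rest' => (a, some t) :: rest')
end

/-- Normal order reduction relation. -/
def NOrd (phi : L) (t t' : Tm L) : Prop := nordRed phi t = some t'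

end Extra
end Tm
end PhiCalc

namespace PhiCalc
namespace Tm

/-- Induction principle for terms and attribute lists simultaneously. -/
theorem induction_both {L : Type} {P : Tm L → Prop} {Q : List (L × Option (Tm L)) → Prop}
    (loc : ∀ n, P (loc n)) (dot : ∀ t a, P t → P (dot t a))
    (app : ∀ t a u, P t → P u → P (app t a u)) (obj : ∀ l, Q l → P (obj l))
    (nil : Q []) (void : ∀ a l, Q l → Q ((a, none) :: l))
    (attached : ∀ a t l, P t → Q l → Q ((a, some t) :: l)) :
    (∀ t, P t) ∧ ∀ l, Q l := by
  have h : ∀ t, P t := fun t => Tm.rec (motive_1 := P) (motive_2 := Q)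
    (motive_3 := fun p => ∀ l, Q l → Q (p :: l))
    (motive_4 := fun o => ∀ a l, Q l → Q ((a, o) :: l))
    loc (fun t a => dot t a) (fun t a u => app t a u) obj nil
    (fun _ l hp hl => hp l hl) (fun a _ ho => ho a) void
    (fun t ht a l hl => attached a t l ht hl) t
  refine ⟨h, fun l => ?_⟩
  induction l with
  | nil => exact nil
  | cons p l ih =>
    obtain ⟨a, _ | t⟩ := p
    · exact void a l ih
    · exact attached a t l (h t) ih

section Locators

variable {L : Type}

theorem incAt_incAt_both :
    (∀ (t : Tm L) (k n : ℕ), k ≤ n → incAt (n + 1) (incAt k t) = incAt k (incAt n t)) ∧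
    ∀ (l : List (L × Option (Tm L))) (k n : ℕ), k ≤ n →
      incAtList (n + 1) (incAtList k l) = incAtList k (incAtList n l) := by
  apply induction_both <;> intros <;> simp_all [incAt, incAtList]
  grind [incAt]

theorem incAt_incAt (t : Tm L) {k n : ℕ} (h : k ≤ n) :
    incAt (n + 1) (incAt k t) = incAt k (incAt n t) :=
  incAt_incAt_both.1 t k n h

theorem incAt_subst_both :
    (∀ (t : Tm L) (k n : ℕ) (u : Tm L), k ≤ n →
      incAt n (subst t k u) = subst (incAt (n + 1) t) k (incAt n u)) ∧
    ∀ (l : List (L × Option (Tm L))) (k n : ℕ) (u : Tm L), k ≤ n →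
      incAtList n (substList l k u) = substList (incAtList (n + 1) l) k (incAt n u) := by
  apply induction_both <;> intros <;>
    simp_all [incAt, incAtList, subst, substList, incAt_incAt]
  grind [incAt, subst]

theorem incAt_subst (t u : Tm L) {k n : ℕ} (h : k ≤ n) :
    incAt n (subst t k u) = subst (incAt (n + 1) t) k (incAt n u) :=
  incAt_subst_both.1 t k n u h

theorem subst_incAt_both :
    (∀ (t : Tm L) (k n : ℕ) (u : Tm L), k ≤ n →
      subst (incAt k t) (n + 1) (incAt k u) = incAt k (subst t n u)) ∧
    ∀ (l : List (L × Option (Tm L))) (k n : ℕ) (u : Tm L), k ≤ n →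
      substList (incAtList k l) (n + 1) (incAt k u) = incAtList k (substList l n u) := by
  apply induction_both <;> intros <;>
    simp_all [incAt, incAtList, subst, substList, ← incAt_incAt]
  grind [incAt, subst]

theorem subst_incAt (t u : Tm L) {k n : ℕ} (h : k ≤ n) :
    subst (incAt k t) (n + 1) (incAt k u) = incAt k (subst t n u) :=
  subst_incAt_both.1 t k n u h

theorem subst_incAt_self_both :
    (∀ (t : Tm L) (k : ℕ) (u : Tm L), subst (incAt k t) k u = t) ∧
    ∀ (l : List (L × Option (Tm L))) (k : ℕ) (u : Tm L),
      substList (incAtList k l) k u = l := by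
  apply induction_both <;> intros <;> simp_all [incAt, incAtList, subst, substList]
  grind [subst]

theorem subst_incAt_self (t u : Tm L) (k : ℕ) : subst (incAt k t) k u = t :=
  subst_incAt_self_both.1 t k u

theorem subst_subst_both :
    (∀ (t : Tm L) (k n : ℕ) (w u : Tm L), k ≤ n →
      subst (subst t k w) n u = subst (subst t (n + 1) (incAt k u)) k (subst w n u)) ∧
    ∀ (l : List (L × Option (Tm L))) (k n : ℕ) (w u : Tm L), k ≤ n →
      substList (substList l k w) n u =
        substList (substList l (n + 1) (incAt k u)) k (subst w n u) := by
  apply induction_both <;> intros <;>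
    simp_all [subst, substList, ← incAt_incAt, ← subst_incAt]
  grind [subst, subst_incAt_self]

theorem subst_subst (t w u : Tm L) {k n : ℕ} (h : k ≤ n) :
    subst (subst t k w) n u = subst (subst t (n + 1) (incAt k u)) k (subst w n u) :=
  subst_subst_both.1 t k n w u h

end Locators

section Attributes

variable {L : Type} [DecidableEq L]

theorem lookupAttr_incAtList (c : L) (n : ℕ) (l : List (L × Option (Tm L))) :
    lookupAttr c (incAtList n l) = (lookupAttr c l).map (Option.map (incAt n)) := by
  induction l with
  | nil => rfl
  | cons p l ih =>
    obtain ⟨a, _ | t⟩ := p <;> simp only [incAtList, lookupAttr] <;> split <;> simp [ih]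

theorem lookupAttr_substList (c : L) (n : ℕ) (u : Tm L) (l : List (L × Option (Tm L))) :
    lookupAttr c (substList l n u) =
      (lookupAttr c l).map (Option.map fun t => subst t n u) := by
  induction l with
  | nil => rfl
  | cons p l ih =>
    obtain ⟨a, _ | t⟩ := p <;> simp only [substList, lookupAttr] <;> split <;> simp [ih]

theorem incAtList_attachAttr (c : L) (n : ℕ) (u : Tm L) (l : List (L × Option (Tm L))) :
    incAtList n (attachAttr c u l) = attachAttr c (incAt n u) (incAtList n l) := by
  induction l with
  | nil => rfl
  | cons p l ih =>
    obtain ⟨a, _ | t⟩ := p <;> simp only [incAtList, attachAttr] <;> split <;>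
      simp [ih, incAtList]

theorem substList_attachAttr (c : L) (n : ℕ) (u v : Tm L) (l : List (L × Option (Tm L))) :
    substList (attachAttr c u l) n v = attachAttr c (subst u n v) (substList l n v) := by
  induction l with
  | nil => rfl
  | cons p l ih =>
    obtain ⟨a, _ | t⟩ := p <;> simp only [substList, attachAttr] <;> split <;>
      simp [ih, substList]

variable {phi : L}

theorem ParAttrs.lookupAttr {l l' : List (L × Option (Tm L))} (h : ParAttrs phi l l') (c : L) :
    Option.Rel (Option.Rel (Par phi)) (lookupAttr c l) (lookupAttr c l') := by
  induction l generalizing l' with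
  | nil => cases h; exact .none
  | cons p l ih =>
    cases h with
    | void a h =>
      simp only [Tm.lookupAttr]
      split
      · exact .some .none
      · exact ih h
    | attached a ht h =>
      simp only [Tm.lookupAttr]
      split
      · exact .some (.some ht)
      · exact ih h

theorem ParAttrs.lookupAttr_eq_none {l l' : List (L × Option (Tm L))} (h : ParAttrs phi l l')
    {c : L} (hc : Tm.lookupAttr c l = none) : Tm.lookupAttr c l' = none := by
  have := h.lookupAttr c
  rw [hc] at this
  generalize Tm.lookupAttr c l' = o at this
  cases this
  rfl

theorem ParAttrs.lookupAttr_isSome {l l' : List (L × Option (Tm L))} (h : ParAttrs phi l l')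
    {c : L} (hc : (Tm.lookupAttr c l).isSome) : (Tm.lookupAttr c l').isSome := by
  have := h.lookupAttr c
  generalize Tm.lookupAttr c l = o at this hc
  generalize Tm.lookupAttr c l' = o' at this
  cases this with
  | some => rfl
  | none => exact hc

theorem ParAttrs.lookupAttr_eq_void {l l' : List (L × Option (Tm L))} (h : ParAttrs phi l l')
    {c : L} (hc : Tm.lookupAttr c l = some none) : Tm.lookupAttr c l' = some none := by
  have := h.lookupAttr c
  rw [hc] at this
  generalize Tm.lookupAttr c l' = o at this
  rcases this with ⟨⟨⟩⟩
  rfl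

theorem ParAttrs.lookupAttr_eq_attached {l l' : List (L × Option (Tm L))}
    (h : ParAttrs phi l l') {c : L} {t : Tm L} (hc : Tm.lookupAttr c l = some (some t)) :
    ∃ t', Tm.lookupAttr c l' = some (some t') ∧ Par phi t t' := by
  have := h.lookupAttr c
  rw [hc] at this
  generalize Tm.lookupAttr c l' = o at this
  rcases this with ⟨⟨ht⟩⟩
  exact ⟨_, rfl, ht⟩

theorem ParAttrs.attachAttr {l l' : List (L × Option (Tm L))} (h : ParAttrs phi l l') (c : L)
    {u u' : Tm L} (hu : Par phi u u') :
    ParAttrs phi (attachAttr c u l) (attachAttr c u' l') := by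
  induction l generalizing l' with
  | nil => cases h; exact .nil
  | cons p l ih =>
    cases h with
    | void a h =>
      simp only [Tm.attachAttr]
      split
      · exact .attached a hu h
      · exact .void a (ih h)
    | attached a ht h =>
      simp only [Tm.attachAttr]
      split
      · exact .attached a hu h
      · exact .attached a ht (ih h)

end Attributes

section Parallel

variable {L : Type} [DecidableEq L] {phi : L}

mutual

theorem Par.incAt {t t' : Tm L} (h : Par phi t t') (n : ℕ) :
    Par phi (incAt n t) (incAt n t') := by
  match h with
  | .loc m =>
    simp only [Tm.incAt]
    split <;> exact .loc _
  | .obj h => simpa only [Tm.incAt] using .obj (h.incAtList (n + 1))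
  | .congDot a h => simpa only [Tm.incAt] using .congDot a (h.incAt n)
  | .congApp a h hu => simpa only [Tm.incAt] using .congApp a (h.incAt n) (hu.incAt n)
  | .dotPar h hc =>
    have ht := h.incAt n
    simp only [Tm.incAt] at ht
    simpa only [incAt_subst _ _ n.zero_le, Tm.incAt] using
      Par.dotPar ht (by rw [lookupAttr_incAtList, hc]; rfl)
  | .dotPhi h hc hp =>
    have ht := h.incAt n
    simp only [Tm.incAt] at ht
    simpa only [Tm.incAt] using
      Par.dotPhi ht (by rw [lookupAttr_incAtList, hc]; rfl)
        (by simpa [lookupAttr_incAtList] using hp)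
  | .appPar h hc hu =>
    have ht := h.incAt n
    simp only [Tm.incAt] at ht
    simpa only [Tm.incAt, incAtList_attachAttr, incAt_incAt _ n.zero_le] using
      Par.appPar ht (by rw [lookupAttr_incAtList, hc]; rfl) (hu.incAt n)
termination_by structural h

theorem ParAttrs.incAtList {l l' : List (L × Option (Tm L))} (h : ParAttrs phi l l') (n : ℕ) :
    ParAttrs phi (incAtList n l) (incAtList n l') := by
  match h with
  | .nil => exact .nil
  | .void a h => simpa only [Tm.incAtList] using .void a (h.incAtList n)
  | .attached a ht h => simpa only [Tm.incAtList] using .attached a (ht.incAt n) (h.incAtList n)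
termination_by structural h

end

mutual

theorem Par.subst {t t' : Tm L} (h : Par phi t t') (n : ℕ) {u u' : Tm L} (hu : Par phi u u') :
    Par phi (subst t n u) (subst t' n u') := by
  match h with
  | .loc m =>
    simp only [Tm.subst]
    split
    · exact .loc _
    · split
      · exact hu
      · exact .loc _
  | .obj h => simpa only [Tm.subst] using .obj (h.substList (n + 1) (hu.incAt 0))
  | .congDot a h => simpa only [Tm.subst] using .congDot a (h.subst n hu)
  | .congApp a h hv => simpa only [Tm.subst] using .congApp a (h.subst n hu) (hv.subst n hu)
  | .dotPar h hc =>
    have ht := h.subst n hu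
    simp only [Tm.subst] at ht
    simpa only [subst_subst _ _ _ n.zero_le, Tm.subst] using
      Par.dotPar ht (by rw [lookupAttr_substList, hc]; rfl)
  | .dotPhi h hc hp =>
    have ht := h.subst n hu
    simp only [Tm.subst] at ht
    simpa only [Tm.subst] using
      Par.dotPhi ht (by rw [lookupAttr_substList, hc]; rfl)
        (by simpa [lookupAttr_substList] using hp)
  | .appPar h hc hv =>
    have ht := h.subst n hu
    simp only [Tm.subst] at ht
    simpa only [Tm.subst, substList_attachAttr, subst_incAt _ _ n.zero_le] using
      Par.appPar ht (by rw [lookupAttr_substList, hc]; rfl) (hv.subst n hu)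
termination_by structural h

theorem ParAttrs.substList {l l' : List (L × Option (Tm L))} (h : ParAttrs phi l l') (n : ℕ)
    {u u' : Tm L} (hu : Par phi u u') :
    ParAttrs phi (substList l n u) (substList l' n u') := by
  match h with
  | .nil => exact .nil
  | .void a h => simpa only [Tm.substList] using .void a (h.substList n hu)
  | .attached a ht h =>
    simpa only [Tm.substList] using .attached a (ht.subst n hu) (h.substList n hu)
termination_by structural h

end

theorem Par.exists_of_obj {l : List (L × Option (Tm L))} {t : Tm L} (h : Par phi (Tm.obj l) t) :
    ∃ l', t = Tm.obj l' ∧ ParAttrs phi l l' := by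
  cases h with
  | obj h => exact ⟨_, rfl, h⟩

mutual

/-- Every parallel reduct of `t` reduces in parallel to the complete development of `t`. -/
theorem Par.par_cd {t t' : Tm L} (h : Par phi t t') : Par phi t' (cd phi t) := by
  match h with
  | .loc m => simpa only [cd] using .loc m
  | .obj h => simpa only [cd] using .obj h.parAttrs_cdList
  | .congDot a h =>
    have ih := h.par_cd
    simp only [cd]
    split
    · next l hl =>
      rw [hl] at ih
      split
      · next hc => exact .dotPar ih hc
      · exact .congDot a ih
      · next hc =>
        split
        · next hp => exact .dotPhi ih hc hp
        · exact .congDot a ih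
    · exact .congDot a ih
  | .congApp a h hu =>
    have ih := h.par_cd
    have ihu := hu.par_cd
    simp only [cd]
    split
    · next l hl =>
      rw [hl] at ih
      split
      · next hc => exact .appPar ih hc ihu
      · exact .congApp a ih ihu
    · exact .congApp a ih ihu
  | .dotPar h hc =>
    have ih := h.par_cd
    obtain ⟨l, hl, hll⟩ := ih.exists_of_obj
    obtain ⟨tc', hc', htc⟩ := hll.lookupAttr_eq_attached hc
    simp only [cd, hl, hc']
    exact htc.subst 0 (.obj hll)
  | .dotPhi h hc hp =>
    have ih := h.par_cd
    obtain ⟨l, hl, hll⟩ := ih.exists_of_obj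
    simp only [cd, hl, hll.lookupAttr_eq_none hc, hll.lookupAttr_isSome hp, if_true]
    exact .congDot _ (.congDot _ (.obj hll))
  | .appPar h hc hu =>
    have ih := h.par_cd
    have ihu := hu.par_cd
    obtain ⟨l, hl, hll⟩ := ih.exists_of_obj
    simp only [cd, hl, hll.lookupAttr_eq_void hc]
    exact .obj (hll.attachAttr _ (ihu.incAt 0))
termination_by structural h

theorem ParAttrs.parAttrs_cdList {l l' : List (L × Option (Tm L))} (h : ParAttrs phi l l') :
    ParAttrs phi l' (cdList phi l) := by
  match h with
  | .nil => simpa only [cdList] using .nil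
  | .void a h => simpa only [cdList] using .void a h.parAttrs_cdList
  | .attached a ht h => simpa only [cdList] using .attached a ht.par_cd h.parAttrs_cdList
termination_by structural h

end

end Parallel

end Tm
end PhiCalc

open PhiCalc Tm in
/-- Diamond property of parallel reduction. -/
theorem par_diamond {L : Type} [DecidableEq L] (phi : L) {t u v : Tm L}
    (htu : Par phi t u) (htv : Par phi t v) :
    ∃ w : Tm L, Par phi u w ∧ Par phi v w := by
  exact ⟨cd phi t, htu.par_cd, htv.par_cd⟩
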